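/- Let d, N ≥ 1 be integers, let C ≥ 0, and let ψ : ℝ^d × S^{N−1} → [0,+∞) satisfy ψ(λ, ν) ≤ C‖λ‖ for all λ ∈ ℝ^d and ν ∈ S^{N−1} (so that Φ is real-valued). Then Φ is Lipschitz continuous on ℝ^{d×N} with Lipschitz constant C·√N with respect to the Frobenius norm: |Φ(M₁) − Φ(M₂)| ≤ C·√N·‖M₁ − M₂‖ for all M₁, M₂ ∈ ℝ^{d×N}; in particular Φ is continuous. -/

import Mathlib

open scoped BigOperators ENNReal

/-- The dyadic (tensor) product `λ⊗ν`, a `d × N` real matrix with entries `λ_i ν_j`. -/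
def outer {d N : ℕ} (l : EuclideanSpace ℝ (Fin d)) (v : EuclideanSpace ℝ (Fin N)) :
    Matrix (Fin d) (Fin N) ℝ :=
  Matrix.of fun i j => l i * v j

/-- The Frobenius norm of a `d × N` real matrix. -/
noncomputable def frobNorm {d N : ℕ} (M : Matrix (Fin d) (Fin N) ℝ) : ℝ :=
  Real.sqrt (∑ i, ∑ j, (M i j) ^ 2)

/-- The function `Φ(M) := inf { Σᵢ ψ(λᵢ,νᵢ) : Σᵢ λᵢ⊗νᵢ = M, ‖νᵢ‖ = 1 }`,
with values in `[0,+∞]`. -/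
noncomputable def Phi {d N : ℕ}
    (ψ : EuclideanSpace ℝ (Fin d) → EuclideanSpace ℝ (Fin N) → ℝ)
    (M : Matrix (Fin d) (Fin N) ℝ) : ℝ≥0∞ :=
  sInf { x : ℝ≥0∞ | ∃ (m : ℕ) (l : Fin m → EuclideanSpace ℝ (Fin d))
    (v : Fin m → EuclideanSpace ℝ (Fin N)),
    (∀ i, ‖v i‖ = 1) ∧ (∑ i, outer (l i) (v i)) = M ∧
    x = ENNReal.ofReal (∑ i, ψ (l i) (v i)) }

theorem Phi_le_of_decomposition {d N m : ℕ}
    (ψ : EuclideanSpace ℝ (Fin d) → EuclideanSpace ℝ (Fin N) → ℝ)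
    (l : Fin m → EuclideanSpace ℝ (Fin d)) (v : Fin m → EuclideanSpace ℝ (Fin N))
    (hv : ∀ i, ‖v i‖ = 1) :
    Phi ψ (∑ i, outer (l i) (v i)) ≤ ENNReal.ofReal (∑ i, ψ (l i) (v i)) :=
  sInf_le ⟨m, l, v, hv, rfl, rfl⟩

theorem Phi_add_le {d N : ℕ} {ψ : EuclideanSpace ℝ (Fin d) → EuclideanSpace ℝ (Fin N) → ℝ}
    (hψ : ∀ l v, ‖v‖ = 1 → 0 ≤ ψ l v) (A B : Matrix (Fin d) (Fin N) ℝ) :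
    Phi ψ (A + B) ≤ Phi ψ A + Phi ψ B := by
  conv_rhs => rw [Phi, Phi, ENNReal.sInf_add]
  refine le_iInf₂ fun a ha => ?_
  rw [ENNReal.add_sInf]
  refine le_iInf₂ fun b hb => ?_
  obtain ⟨m, l, v, hv, rfl, rfl⟩ := ha
  obtain ⟨n, l', v', hv', rfl, rfl⟩ := hb
  rw [← ENNReal.ofReal_add (Finset.sum_nonneg fun i _ => hψ _ _ (hv i))
    (Finset.sum_nonneg fun i _ => hψ _ _ (hv' i))]
  have h := Phi_le_of_decomposition ψ (Fin.append l l') (Fin.append v v')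
    (fun i => Fin.addCases (by simpa using hv) (by simpa using hv') i)
  simpa [Fin.sum_univ_add] using h

theorem sum_norm_col_le_frobNorm {d N : ℕ} (M : Matrix (Fin d) (Fin N) ℝ) :
    ∑ j, ‖WithLp.toLp 2 (M.col j)‖ ≤ Real.sqrt N * frobNorm M := by
  rw [frobNorm, ← Real.sqrt_mul (Nat.cast_nonneg N)]
  refine Real.le_sqrt_of_sq_le (sq_sum_le_card_mul_sum_sq.trans (le_of_eq ?_))
  rw [Finset.card_univ, Fintype.card_fin, Finset.sum_comm]
  simp [EuclideanSpace.norm_sq_eq]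

theorem sum_outer_col_single {d N : ℕ} (M : Matrix (Fin d) (Fin N) ℝ) :
    ∑ j, outer (WithLp.toLp 2 (M.col j)) (EuclideanSpace.single j 1) = M := by
  ext i k
  simp [outer, Matrix.sum_apply]

theorem Phi_le_frobNorm {d N : ℕ} {C : ℝ} (hC : 0 ≤ C)
    {ψ : EuclideanSpace ℝ (Fin d) → EuclideanSpace ℝ (Fin N) → ℝ}
    (hψ : ∀ l v, ‖v‖ = 1 → ψ l v ≤ C * ‖l‖) (M : Matrix (Fin d) (Fin N) ℝ) :
    Phi ψ M ≤ ENNReal.ofReal (C * Real.sqrt N * frobNorm M) := by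
  have hv (j : Fin N) : ‖EuclideanSpace.single j (1 : ℝ)‖ = 1 := by simp
  have h := Phi_le_of_decomposition ψ (fun j => WithLp.toLp 2 (M.col j)) _ hv
  rw [sum_outer_col_single] at h
  refine h.trans (ENNReal.ofReal_le_ofReal ?_)
  calc _ ≤ ∑ j, C * ‖WithLp.toLp 2 (M.col j)‖ := Finset.sum_le_sum fun j _ => hψ _ _ (hv j)
    _ = C * ∑ j, ‖WithLp.toLp 2 (M.col j)‖ := (Finset.mul_sum ..).symm
    _ ≤ C * (Real.sqrt N * frobNorm M) :=
      mul_le_mul_of_nonneg_left (sum_norm_col_le_frobNorm M) hC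
    _ = _ := (mul_assoc ..).symm

theorem frobNorm_sub_comm {d N : ℕ} (A B : Matrix (Fin d) (Fin N) ℝ) :
    frobNorm (A - B) = frobNorm (B - A) := by
  simp only [frobNorm, Matrix.sub_apply, sub_sq_comm]

theorem continuous_frobNorm {d N : ℕ} :
    Continuous (frobNorm : Matrix (Fin d) (Fin N) ℝ → ℝ) := by
  unfold frobNorm
  fun_prop

/-- If `ψ(λ,ν) ≤ C‖λ‖`, then `Φ` is real-valued and Lipschitz continuous with constant
`C·√N` with respect to the Frobenius norm; in particular `Φ` is continuous. -/
theorem stmt9 (d N : ℕ) (hd : 1 ≤ d) (hN : 1 ≤ N) (C : ℝ) (hC : 0 ≤ C)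
    (ψ : EuclideanSpace ℝ (Fin d) → EuclideanSpace ℝ (Fin N) → ℝ)
    (hnonneg : ∀ (l : EuclideanSpace ℝ (Fin d)) (v : EuclideanSpace ℝ (Fin N)),
      ‖v‖ = 1 → 0 ≤ ψ l v)
    (hbound : ∀ (l : EuclideanSpace ℝ (Fin d)) (v : EuclideanSpace ℝ (Fin N)),
      ‖v‖ = 1 → ψ l v ≤ C * ‖l‖) :
    (∀ M : Matrix (Fin d) (Fin N) ℝ, Phi ψ M ≠ ⊤) ∧
    (∀ M₁ M₂ : Matrix (Fin d) (Fin N) ℝ,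
      |(Phi ψ M₁).toReal - (Phi ψ M₂).toReal| ≤ C * Real.sqrt N * frobNorm (M₁ - M₂)) ∧
    Continuous fun M : Matrix (Fin d) (Fin N) ℝ => (Phi ψ M).toReal := by
  have hfin (M : Matrix (Fin d) (Fin N) ℝ) : Phi ψ M ≠ ⊤ :=
    ((Phi_le_frobNorm hC hbound M).trans_lt ENNReal.ofReal_lt_top).ne
  have hsub (A B : Matrix (Fin d) (Fin N) ℝ) :
      (Phi ψ A).toReal - (Phi ψ B).toReal ≤ C * Real.sqrt N * frobNorm (A - B) := by
    have hK : 0 ≤ C * Real.sqrt N * frobNorm (A - B) :=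
      mul_nonneg (mul_nonneg hC (Real.sqrt_nonneg _)) (Real.sqrt_nonneg _)
    have h := Phi_add_le hnonneg (A - B) B
    rw [sub_add_cancel] at h
    have h₁ := ENNReal.toReal_mono (ENNReal.add_ne_top.2 ⟨hfin _, hfin _⟩) h
    rw [ENNReal.toReal_add (hfin _) (hfin _)] at h₁
    have h₂ := ENNReal.toReal_le_of_le_ofReal hK (Phi_le_frobNorm hC hbound (A - B))
    linarith
  have hlip (A B : Matrix (Fin d) (Fin N) ℝ) :
      |(Phi ψ A).toReal - (Phi ψ B).toReal| ≤ C * Real.sqrt N * frobNorm (A - B) :=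
    abs_sub_le_iff.2 ⟨hsub A B, frobNorm_sub_comm A B ▸ hsub B A⟩
  refine ⟨hfin, hlip, continuous_iff_continuousAt.2 fun M => ?_⟩
  refine tendsto_iff_dist_tendsto_zero.2 (squeeze_zero (fun _ => dist_nonneg)
    (fun A => hlip A M) ?_)
  have h : Continuous fun A : Matrix (Fin d) (Fin N) ℝ => C * Real.sqrt N * frobNorm (A - M) :=
    continuous_const.mul (continuous_frobNorm.comp (continuous_id.sub continuous_const))
  simpa [frobNorm] using h.tendsto M
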